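/- Let m and n be coprime positive integers and let p be an (m,n)-parking word. Then the action of p on V^m has exactly one fixed point. -/

import Mathlib

def IsParkingWord (m n : ℕ) (p : Fin n → ℕ) : Prop :=
  (∀ j, p j < m) ∧
  ∀ i : ℕ, 1 ≤ i → i ≤ m →
    i * n ≤ m * (Finset.univ.filter (fun j => p j < i)).card

noncomputable def sortTuple {m : ℕ} (x : Fin m → ℝ) : Fin m → ℝ :=
  x ∘ Tuple.sort x

noncomputable def letterAct (m : ℕ) (i : Fin m) (x : Fin m → ℝ) : Fin m → ℝ :=
  sortTuple (fun j => x j + (if j = i then (m : ℝ) else 0) - 1)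

noncomputable def wordAct {m n : ℕ} (w : Fin n → Fin m) (x : Fin m → ℝ) : Fin m → ℝ :=
  (List.ofFn w).foldl (fun y i => letterAct m i y) x

def Vm (m : ℕ) : Set (Fin m → ℝ) :=
  {x | (∑ j, x j) = 0 ∧ Monotone x}

/-- The first `i` coordinates. -/
abbrev lowerIndices (m i : ℕ) : Finset (Fin m) := Finset.univ.filter fun j => (j : ℕ) < i

section Sorting

variable {m : ℕ}

lemma monotone_sortTuple (x : Fin m → ℝ) : Monotone (sortTuple x) :=
  Tuple.monotone_sort x

lemma sum_sortTuple (x : Fin m → ℝ) : ∑ j, sortTuple x j = ∑ j, x j :=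
  Equiv.sum_comp (Tuple.sort x) x

/-- Sorting turns the squared distance into a rearrangement problem. -/
lemma exists_perm_sum_sq_sub (u v : Fin m → ℝ) : ∃ ρ : Equiv.Perm (Fin m),
    sortTuple v ∘ ρ = v ∘ Tuple.sort u ∧
    ∑ j, (u j - v j) ^ 2 = ∑ j, (sortTuple u j - sortTuple v j) ^ 2 +
      2 * (∑ j, sortTuple u j * sortTuple v j - ∑ j, sortTuple u j * sortTuple v (ρ j)) := by
  set ρ : Equiv.Perm (Fin m) := (Tuple.sort u).trans (Tuple.sort v).symm with hρ
  have hv : sortTuple v ∘ ρ = v ∘ Tuple.sort u := by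
    ext j
    simp [sortTuple, hρ]
  refine ⟨ρ, hv, ?_⟩
  have h1 : ∑ j, (u j - v j) ^ 2 = ∑ j, (sortTuple u j - sortTuple v (ρ j)) ^ 2 := by
    rw [← Equiv.sum_comp (Tuple.sort u)]
    refine Finset.sum_congr rfl fun j _ => ?_
    rw [show sortTuple v (ρ j) = v (Tuple.sort u j) from congrFun hv j]
    rfl
  have h2 : ∑ j, sortTuple v (ρ j) ^ 2 = ∑ j, sortTuple v j ^ 2 :=
    Equiv.sum_comp ρ fun j => sortTuple v j ^ 2
  rw [h1]
  simp only [sub_sq, Finset.sum_add_distrib, Finset.sum_sub_distrib, mul_assoc, ← Finset.mul_sum,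
    h2]
  ring

lemma sum_sq_sortTuple_sub_le (u v : Fin m → ℝ) :
    ∑ j, (sortTuple u j - sortTuple v j) ^ 2 ≤ ∑ j, (u j - v j) ^ 2 := by
  obtain ⟨ρ, -, h⟩ := exists_perm_sum_sq_sub u v
  have hmono : Monovary (sortTuple u) (sortTuple v) :=
    (monotone_sortTuple u).monovary (monotone_sortTuple v)
  have := hmono.sum_mul_comp_perm_le_sum_mul (σ := ρ)
  linarith

/-- If sorting preserves the distance between two tuples, one permutation sorts both. -/
lemma exists_common_sort_of_sum_sq_eq (u v : Fin m → ℝ)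
    (heq : ∑ j, (sortTuple u j - sortTuple v j) ^ 2 = ∑ j, (u j - v j) ^ 2) :
    ∃ π : Equiv.Perm (Fin m), sortTuple u = u ∘ π ∧ sortTuple v = v ∘ π := by
  obtain ⟨ρ, hv, h⟩ := exists_perm_sum_sq_sub u v
  have hmono : Monovary (sortTuple u) (sortTuple v) :=
    (monotone_sortTuple u).monovary (monotone_sortTuple v)
  have hmv : Monovary (u ∘ Tuple.sort u) (v ∘ Tuple.sort u) := by
    rw [← hv]
    exact (hmono.sum_mul_comp_perm_eq_sum_mul_iff (σ := ρ)).1 (by linarith)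
  have huv : ∀ a b, v a < v b → u a ≤ u b := fun a b hab => by
    simpa using @hmv ((Tuple.sort u).symm a) ((Tuple.sort u).symm b) (by simpa using hab)
  have hsum := Tuple.monotone_sort (u + v)
  refine ⟨Tuple.sort (u + v), ?_, ?_⟩
  · refine (Tuple.comp_sort_eq_comp_iff_monotone.2 fun a b hab => ?_).symm
    have := hsum hab
    simp only [Function.comp_apply, Pi.add_apply] at this ⊢
    by_contra! hlt
    rcases lt_or_ge (v (Tuple.sort (u + v) a)) (v (Tuple.sort (u + v) b)) with hv | hv
    · linarith [huv _ _ hv]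
    · linarith
  · refine (Tuple.comp_sort_eq_comp_iff_monotone.2 fun a b hab => ?_).symm
    have := hsum hab
    simp only [Function.comp_apply, Pi.add_apply] at this ⊢
    by_contra! hlt
    linarith [huv _ _ hlt]

/-- If the entries in positions `< i` are all below the others, sorting respects the cut at `i`. -/
lemma sort_lt_iff_of_cut {u : Fin m → ℝ} {i : ℕ}
    (hu : ∀ a b : Fin m, (a : ℕ) < i → i ≤ b → u a < u b) (j : Fin m) :
    (Tuple.sort u j : ℕ) < i ↔ (j : ℕ) < i := by
  set σ := Tuple.sort u with hσ
  set S : Finset (Fin m) := lowerIndices m i with hS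
  have hcard : (S.map σ.toEmbedding).card = S.card := Finset.card_map _
  have hsub : S.map σ.toEmbedding ⊆ S := by
    by_contra hnot
    have hnot' : ¬ S ⊆ S.map σ.toEmbedding := fun h =>
      hnot (Finset.eq_of_subset_of_card_le h hcard.le).ge
    obtain ⟨b, hb, hbS⟩ := Finset.not_subset.1 hnot
    obtain ⟨a, ha, haS⟩ := Finset.not_subset.1 hnot'
    obtain ⟨j, hj, rfl⟩ := Finset.mem_map.1 hb
    obtain ⟨k, rfl⟩ := σ.surjective a
    have hk : ¬ (k : ℕ) < i := fun hk =>
      haS (Finset.mem_map_of_mem σ.toEmbedding (by simpa [hS] using hk))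
    simp only [hS, Finset.mem_filter, Finset.mem_univ, true_and, Equiv.coe_toEmbedding] at ha hj hbS
    have h1 := hu _ _ ha (not_lt.1 hbS)
    have h2 : u (σ j) ≤ u (σ k) := Tuple.monotone_sort u (show j ≤ k by
      rw [Fin.le_def]; omega)
    linarith
  have heq := Finset.eq_of_subset_of_card_le hsub hcard.ge
  have hmem : σ j ∈ S ↔ j ∈ S := by
    conv_lhs => rw [← heq]
    exact Finset.mem_map' σ.toEmbedding
  simpa [hS] using hmem

end Sorting

section Action

variable {m : ℕ}

lemma sum_letterAct (i : Fin m) (x : Fin m → ℝ) : ∑ j, letterAct m i x j = ∑ j, x j := by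
  rw [letterAct, sum_sortTuple]
  simp [Finset.sum_add_distrib]

lemma sum_foldl_letterAct (w : List (Fin m)) (x : Fin m → ℝ) :
    ∑ j, w.foldl (fun y i => letterAct m i y) x j = ∑ j, x j := by
  induction w generalizing x with
  | nil => rfl
  | cons i w ih => rw [List.foldl_cons, ih, sum_letterAct]

lemma monotone_foldl_letterAct (w : List (Fin m)) (hw : w ≠ []) (x : Fin m → ℝ) :
    Monotone (w.foldl (fun y i => letterAct m i y) x) := by
  rw [← List.dropLast_append_getLast hw, List.foldl_append, List.foldl_cons, List.foldl_nil]
  exact monotone_sortTuple _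

lemma sum_sq_letterAct_sub_le (i : Fin m) (x y : Fin m → ℝ) :
    ∑ j, (letterAct m i x j - letterAct m i y j) ^ 2 ≤ ∑ j, (x j - y j) ^ 2 := by
  refine (sum_sq_sortTuple_sub_le _ _).trans_eq (Finset.sum_congr rfl fun j _ => ?_)
  ring

lemma sum_sq_foldl_letterAct_sub_le (w : List (Fin m)) (x y : Fin m → ℝ) :
    ∑ j, (w.foldl (fun y i => letterAct m i y) x j - w.foldl (fun y i => letterAct m i y) y j) ^ 2
      ≤ ∑ j, (x j - y j) ^ 2 := by
  induction w generalizing x y with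
  | nil => rfl
  | cons i w ih => exact (ih _ _).trans (sum_sq_letterAct_sub_le i x y)

/-- If a word preserves the distance between two points, it acts on both of them by one and the
same affine map: a permutation of the coordinates followed by a translation. -/
lemma exists_perm_of_sum_sq_foldl_eq (w : List (Fin m)) (x y : Fin m → ℝ)
    (h : ∑ j, (w.foldl (fun y i => letterAct m i y) x j -
      w.foldl (fun y i => letterAct m i y) y j) ^ 2 = ∑ j, (x j - y j) ^ 2) :
    ∃ (π : Equiv.Perm (Fin m)) (k : Fin m → ℤ), ∀ j,
      w.foldl (fun y i => letterAct m i y) x j = x (π j) + m * k j - w.length ∧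
      w.foldl (fun y i => letterAct m i y) y j = y (π j) + m * k j - w.length := by
  induction w generalizing x y with
  | nil => exact ⟨1, 0, by simp⟩
  | cons i w ih =>
    have h1 := sum_sq_letterAct_sub_le i x y
    have h2 := sum_sq_foldl_letterAct_sub_le w (letterAct m i x) (letterAct m i y)
    rw [List.foldl_cons, List.foldl_cons] at h
    obtain ⟨π, k, hk⟩ := ih _ _ (h2.antisymm (h ▸ h1))
    obtain ⟨τ, hx, hy⟩ := exists_common_sort_of_sum_sq_eq
      (fun j => x j + (if j = i then (m : ℝ) else 0) - 1)
      (fun j => y j + (if j = i then (m : ℝ) else 0) - 1) (by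
        have h3 : ∑ j, (letterAct m i x j - letterAct m i y j) ^ 2 = ∑ j, (x j - y j) ^ 2 :=
          h1.antisymm (h ▸ h2)
        refine Eq.trans h3 (Finset.sum_congr rfl fun j _ => ?_)
        ring)
    refine ⟨π.trans τ, fun j => k j + if τ (π j) = i then 1 else 0, fun j => ?_⟩
    have hxj : letterAct m i x (π j) = _ := congrFun hx (π j)
    have hyj : letterAct m i y (π j) = _ := congrFun hy (π j)
    rw [List.foldl_cons, List.foldl_cons, (hk j).1, (hk j).2, hxj, hyj]
    simp only [Function.comp_apply, Equiv.trans_apply, List.length_cons]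
    split_ifs <;> push_cast <;> constructor <;> ring

/-- Across a wide gap at position `i`, a word moves the sum of the lower coordinates by a
translation determined by its letters. -/
lemma sum_lower_foldl_letterAct {i : ℕ} (hi : i ≤ m) (w : List (Fin m)) (x : Fin m → ℝ)
    (hx : ∀ a b : Fin m, (a : ℕ) < i → i ≤ b → x a + m * w.length < x b) :
    ∑ j ∈ lowerIndices m i, w.foldl (fun y i => letterAct m i y) x j =
      ∑ j ∈ lowerIndices m i, x j +
        (w.map fun l : Fin m => (if (l : ℕ) < i then (m : ℝ) else 0) - i).sum := by
  induction w generalizing x with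
  | nil => simp
  | cons l w ih =>
    set u : Fin m → ℝ := fun j => x j + (if j = l then (m : ℝ) else 0) - 1 with hu
    have hm : (0 : ℝ) ≤ m := m.cast_nonneg
    have hgap : ∀ a b : Fin m, (a : ℕ) < i → i ≤ b → u a + m * w.length < u b := by
      intro a b ha hb
      have h := hx a b ha hb
      simp only [List.length_cons, Nat.cast_add, Nat.cast_one, mul_add, mul_one] at h
      simp only [hu]
      split_ifs <;> linarith
    have hcut := sort_lt_iff_of_cut (u := u) (i := i) fun a b ha hb =>
      lt_of_le_of_lt (le_add_of_nonneg_right (by positivity)) (hgap a b ha hb)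
    rw [List.foldl_cons, ih (letterAct m l x) fun a b ha hb =>
      hgap _ _ ((hcut a).2 ha) (not_lt.1 fun h => absurd ((hcut b).1 h) (not_lt.2 hb))]
    have hsum : ∑ j ∈ lowerIndices m i, letterAct m l x j = ∑ j ∈ lowerIndices m i, u j :=
      Finset.sum_equiv (Tuple.sort u) (fun j => by simp [hcut]) fun j _ => rfl
    have hcard : (lowerIndices m i).card = i := by
      rw [Fin.card_filter_val_lt]; exact min_eq_right hi
    rw [hsum, List.map_cons, List.sum_cons]
    simp only [hu, Finset.sum_sub_distrib, Finset.sum_add_distrib, Finset.sum_ite_eq',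
      Finset.sum_const, hcard, Finset.mem_filter, Finset.mem_univ, true_and, nsmul_eq_mul, mul_one]
    ring

end Action

section WordAct

variable {m n : ℕ}

lemma sum_wordAct (p : Fin n → Fin m) (x : Fin m → ℝ) : ∑ j, wordAct p x j = ∑ j, x j :=
  sum_foldl_letterAct _ _

lemma monotone_wordAct (hn : 0 < n) (p : Fin n → Fin m) (x : Fin m → ℝ) :
    Monotone (wordAct p x) :=
  monotone_foldl_letterAct _ (by rw [Ne, List.ofFn_eq_nil_iff]; exact hn.ne') _

lemma sum_sq_wordAct_sub_le (p : Fin n → Fin m) (x y : Fin m → ℝ) :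
    ∑ j, (wordAct p x j - wordAct p y j) ^ 2 ≤ ∑ j, (x j - y j) ^ 2 :=
  sum_sq_foldl_letterAct_sub_le _ _ _

lemma eq_of_wordAct_eq_self (hcop : Nat.Coprime m n) (p : Fin n → Fin m) {x y : Fin m → ℝ}
    (hsum : ∑ j, x j = ∑ j, y j) (hx : wordAct p x = x) (hy : wordAct p y = y) : x = y := by
  obtain ⟨π, k, hk⟩ := exists_perm_of_sum_sq_foldl_eq (List.ofFn p) x y (by
    change ∑ j, (wordAct p x j - wordAct p y j) ^ 2 = _
    rw [hx, hy])
  change ∀ j, wordAct p x j = _ ∧ wordAct p y j = _ at hk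
  rw [hx, hy, List.length_ofFn] at hk
  funext i
  set A : Finset (Fin m) := Finset.univ.filter fun j => x j - y j = x i - y i with hA
  have hπA : ∀ j, j ∈ A ↔ π j ∈ A := fun j => by
    have : x j - y j = x (π j) - y (π j) := by linarith [(hk j).1, (hk j).2]
    simp [hA, this]
  have hcount : (m : ℝ) * ∑ j ∈ A, k j - A.card * n = 0 := by
    have h1 : ∑ j ∈ A, x (π j) = ∑ j ∈ A, x j := Finset.sum_equiv π hπA fun _ _ => rfl
    have h2 : ∑ j ∈ A, x j = ∑ j ∈ A, (x (π j) + m * k j - n) :=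
      Finset.sum_congr rfl fun j _ => (hk j).1
    simp only [Finset.sum_sub_distrib, Finset.sum_add_distrib, ← Finset.mul_sum, Finset.sum_const,
      nsmul_eq_mul] at h2
    push_cast
    linarith
  have hdvd : m ∣ A.card := by
    refine hcop.dvd_of_dvd_mul_right ?_
    rw [← Int.natCast_dvd_natCast]
    refine ⟨∑ j ∈ A, k j, ?_⟩
    have : (A.card : ℝ) * n = m * ∑ j ∈ A, k j := by linarith
    exact_mod_cast this
  have hAuniv : A = Finset.univ := by
    refine Finset.eq_univ_of_card _ ((Finset.card_le_univ A).antisymm ?_)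
    rw [Fintype.card_fin]
    exact Nat.le_of_dvd (Finset.card_pos.2 ⟨i, by simp [hA]⟩) hdvd
  have hconst : ∀ j, x j - y j = x i - y i := fun j => by
    have : j ∈ A := hAuniv ▸ Finset.mem_univ j
    simpa [hA] using this
  have hzero : (m : ℝ) * (x i - y i) = 0 := by
    have : ∑ j, (x j - y j) = 0 := by rw [Finset.sum_sub_distrib, hsum, sub_self]
    rwa [Finset.sum_congr rfl fun j _ => hconst j, Finset.sum_const, Finset.card_univ,
      Fintype.card_fin, nsmul_eq_mul] at this
  have hm : (m : ℝ) ≠ 0 := Nat.cast_ne_zero.2 (Fin.pos i).ne'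
  exact sub_eq_zero.1 ((mul_eq_zero.1 hzero).resolve_left hm)

lemma IsParkingWord.sum_lower_le {p : Fin n → Fin m}
    (hp : IsParkingWord m n fun j => (p j : ℕ)) {i : ℕ} (hi0 : 0 < i) (hi : i ≤ m)
    {x : Fin m → ℝ} (hx : ∀ a b : Fin m, (a : ℕ) < i → i ≤ b → x a + m * n < x b) :
    ∑ j ∈ lowerIndices m i, x j ≤ ∑ j ∈ lowerIndices m i, wordAct p x j := by
  have h := sum_lower_foldl_letterAct hi (List.ofFn p) x (by simpa using hx)
  have hsum : ((List.ofFn p).map fun l : Fin m => (if (l : ℕ) < i then (m : ℝ) else 0) - i).sum =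
      m * (Finset.univ.filter fun j => (p j : ℕ) < i).card - i * n := by
    rw [List.map_ofFn, List.sum_ofFn]
    simp only [Function.comp_apply, Finset.sum_sub_distrib, ← Finset.sum_filter, Finset.sum_const,
      nsmul_eq_mul, Finset.card_univ, Fintype.card_fin]
    ring
  have hpark : (i : ℝ) * n ≤ m * (Finset.univ.filter fun j => (p j : ℕ) < i).card := by
    exact_mod_cast hp.2 i hi0 hi
  rw [wordAct, h, hsum]
  linarith

lemma sum_lower_neg {x : Fin m → ℝ} (hx : x ∈ Vm m) {i : ℕ} (hi0 : 0 < i) (hi : i < m)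
    (hlt : x ⟨i - 1, by omega⟩ < x ⟨i, hi⟩) : ∑ j ∈ lowerIndices m i, x j < 0 := by
  by_contra! hnn
  have hpos : 0 ≤ x ⟨i - 1, by omega⟩ := by
    by_contra! hneg
    refine absurd hnn (not_le.2 (Finset.sum_neg (fun j hj => ?_) ⟨⟨0, by omega⟩, by simpa⟩))
    have hj' : (j : ℕ) < i := by simpa using hj
    exact (hx.2 (show j ≤ ⟨i - 1, by omega⟩ by rw [Fin.le_def]; simp only; omega)).trans_lt hneg
  have hup : 0 < ∑ j ∈ Finset.univ.filter (fun j : Fin m => ¬ (j : ℕ) < i), x j := by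
    refine Finset.sum_pos (fun j hj => ?_) ⟨⟨i, hi⟩, by simp⟩
    have hj' : ¬ (j : ℕ) < i := by simpa using hj
    exact (hpos.trans_lt hlt).trans_le (hx.2 (by rw [Fin.le_def]; simp only; omega))
  have := Finset.sum_filter_add_sum_filter_not Finset.univ (fun j : Fin m => (j : ℕ) < i) x
  linarith [hx.1]

lemma IsParkingWord.gap_le {p : Fin n → Fin m}
    (hp : IsParkingWord m n fun j => (p j : ℕ)) {c : ℝ} (hc0 : 0 ≤ c) (hc1 : c < 1)
    {x : Fin m → ℝ} (hx : x ∈ Vm m) (hfix : ∀ j, c * wordAct p x j = x j)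
    {i : ℕ} (hi0 : 0 < i) (hi : i < m) :
    x ⟨i, hi⟩ ≤ x ⟨i - 1, by omega⟩ + m * n := by
  by_contra! hgap
  have hneg := sum_lower_neg hx hi0 hi
    (lt_of_le_of_lt (le_add_of_nonneg_right (by positivity)) hgap)
  have hle := hp.sum_lower_le hi0 hi.le (x := x) fun a b ha hb => by
    have h1 : x a ≤ x ⟨i - 1, by omega⟩ := hx.2 (by rw [Fin.le_def]; simp only; omega)
    have h2 : x ⟨i, hi⟩ ≤ x b := hx.2 (by rw [Fin.le_def]; exact hb)
    linarith
  have heq : c * ∑ j ∈ lowerIndices m i, wordAct p x j = ∑ j ∈ lowerIndices m i, x j := by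
    rw [Finset.mul_sum]
    exact Finset.sum_congr rfl fun j _ => hfix j
  nlinarith

lemma abs_le_of_gap_le {x : Fin m → ℝ} (hx : x ∈ Vm m) {d : ℝ} (hd : 0 ≤ d)
    (hgap : ∀ i (hi0 : 0 < i) (hi : i < m), x ⟨i, hi⟩ ≤ x ⟨i - 1, by omega⟩ + d) (j : Fin m) :
    |x j| ≤ m * d := by
  have hm : 0 < m := Fin.pos j
  have hup : ∀ i (hi : i < m), x ⟨i, hi⟩ ≤ x ⟨0, hm⟩ + i * d := by
    intro i
    induction i with
    | zero => simp
    | succ i ih =>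
      intro hi
      have h1 := hgap (i + 1) i.succ_pos hi
      have h2 := ih (by omega)
      simp only [Nat.add_sub_cancel] at h1
      push_cast
      linarith
  have hupm : ∀ j, x j ≤ x ⟨0, hm⟩ + m * d := fun j => (hup j j.2).trans (by
    have : (j : ℝ) ≤ m := by exact_mod_cast j.2.le
    gcongr)
  have hlow : ∀ j, x ⟨0, hm⟩ ≤ x j := fun j => hx.2 (by rw [Fin.le_def]; simp)
  have hne : (Finset.univ : Finset (Fin m)).Nonempty := ⟨j, Finset.mem_univ j⟩
  have h0 : x ⟨0, hm⟩ ≤ 0 := by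
    by_contra! h
    exact (Finset.sum_pos (fun j _ => h.trans_le (hlow j)) hne).ne' hx.1
  have h1 : 0 ≤ x ⟨0, hm⟩ + m * d := by
    by_contra! h
    exact (Finset.sum_neg (fun j _ => (hupm j).trans_lt h) hne).ne hx.1
  rw [abs_le]
  constructor <;> linarith [hupm j, hlow j]

/-- The action of a word, on Euclidean space. -/
noncomputable def euclideanWordAct (p : Fin n → Fin m) (x : EuclideanSpace ℝ (Fin m)) :
    EuclideanSpace ℝ (Fin m) :=
  WithLp.toLp 2 (wordAct p x.ofLp)

lemma lipschitzWith_euclideanWordAct (p : Fin n → Fin m) :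
    LipschitzWith 1 (euclideanWordAct p) := by
  refine LipschitzWith.of_dist_le_mul fun x y => ?_
  rw [NNReal.coe_one, one_mul, EuclideanSpace.dist_eq, EuclideanSpace.dist_eq]
  refine Real.sqrt_le_sqrt ?_
  simp only [Real.dist_eq, sq_abs]
  exact sum_sq_wordAct_sub_le p x.ofLp y.ofLp

/-- Damping the action by a factor `c < 1` produces a fixed point in `Vm m`. -/
lemma exists_damped_fixed_point (hn : 0 < n) (p : Fin n → Fin m) {c : NNReal} (hc : c < 1) :
    ∃ x : EuclideanSpace ℝ (Fin m), x.ofLp ∈ Vm m ∧ (c : ℝ) • euclideanWordAct p x = x := by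
  have hcontr : ContractingWith c fun x => (c : ℝ) • euclideanWordAct p x := by
    refine ⟨hc, LipschitzWith.of_dist_le_mul fun x y => ?_⟩
    rw [dist_smul₀, Real.norm_of_nonneg (NNReal.coe_nonneg c)]
    gcongr
    simpa using (lipschitzWith_euclideanWordAct p).dist_le_mul x y
  obtain ⟨x, hx⟩ : ∃ x, (c : ℝ) • euclideanWordAct p x = x :=
    ⟨_, hcontr.fixedPoint_isFixedPt⟩
  have hxj : ∀ j, (c : ℝ) * wordAct p x.ofLp j = x.ofLp j := fun j =>
    congrFun (congrArg WithLp.ofLp hx) j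
  refine ⟨x, ⟨?_, fun a b hab => ?_⟩, hx⟩
  · have h : (c : ℝ) * ∑ j, x.ofLp j = ∑ j, x.ofLp j := by
      conv_lhs => rw [← sum_wordAct p, Finset.mul_sum]
      exact Finset.sum_congr rfl fun j _ => hxj j
    have hc' : (c : ℝ) < 1 := by exact_mod_cast hc
    have h' : (1 - (c : ℝ)) * ∑ j, x.ofLp j = 0 := by linarith
    exact (mul_eq_zero.1 h').resolve_left (by linarith)
  · rw [← hxj a, ← hxj b]
    exact mul_le_mul_of_nonneg_left (monotone_wordAct hn p _ hab) c.2

lemma IsParkingWord.exists_fixed_point (hn : 0 < n) {p : Fin n → Fin m}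
    (hp : IsParkingWord m n fun j => (p j : ℕ)) :
    ∃ x : Fin m → ℝ, x ∈ Vm m ∧ wordAct p x = x := by
  have hc : ∀ k : ℕ, 1 - 1 / ((k : NNReal) + 1) < 1 := fun k =>
    tsub_lt_self one_pos (by positivity)
  choose x hxV hx using fun k => exists_damped_fixed_point hn p (hc k)
  have hbound : ∀ k, x k ∈ Metric.closedBall (0 : EuclideanSpace ℝ (Fin m))
      (√(∑ _j : Fin m, ((m : ℝ) * (m * n)) ^ 2)) := by
    intro k
    rw [mem_closedBall_zero_iff, EuclideanSpace.norm_eq]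
    refine Real.sqrt_le_sqrt (Finset.sum_le_sum fun j _ => ?_)
    rw [Real.norm_eq_abs]
    refine pow_le_pow_left₀ (abs_nonneg _) (abs_le_of_gap_le (hxV k) (by positivity) ?_ j) 2
    exact fun i hi0 hi => hp.gap_le (NNReal.coe_nonneg _) (by exact_mod_cast hc k) (hxV k)
      (fun j => congrFun (congrArg WithLp.ofLp (hx k)) j) hi0 hi
  obtain ⟨z, -, φ, hφ, hz⟩ := (isCompact_closedBall _ _).tendsto_subseq hbound
  have hclim : Filter.Tendsto (fun k : ℕ => ((1 - 1 / ((k : NNReal) + 1) : NNReal) : ℝ))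
      Filter.atTop (nhds 1) := by
    have h := (tendsto_const_nhds (x := (1 : ℝ))).sub
      (tendsto_one_div_add_atTop_nhds_zero_nat (𝕜 := ℝ))
    rw [sub_zero] at h
    refine h.congr fun k => ?_
    rw [NNReal.coe_sub (by rw [div_le_one (by positivity)]; simp)]
    simp
  have hfixz : euclideanWordAct p z = z := by
    have h1 := (hclim.comp hφ.tendsto_atTop).smul
      (((lipschitzWith_euclideanWordAct p).continuous.tendsto z).comp hz)
    rw [one_smul] at h1
    exact tendsto_nhds_unique (h1.congr fun k => hx (φ k)) hz
  have hfix : wordAct p z.ofLp = z.ofLp := congrArg WithLp.ofLp hfixz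
  refine ⟨z.ofLp, ⟨?_, hfix ▸ monotone_wordAct hn p _⟩, hfix⟩
  have hcont : Continuous fun y : EuclideanSpace ℝ (Fin m) => ∑ j, y.ofLp j := by fun_prop
  refine tendsto_nhds_unique ((hcont.tendsto z).comp hz) ?_
  exact tendsto_const_nhds.congr fun k => ((hxV (φ k)).1).symm

end WordAct

/-- For `m`, `n` coprime, the action of an (m,n)-parking word on `V^m` has
exactly one fixed point. -/
theorem parking_word_unique_fixed_point (m n : ℕ) (hm : 0 < m) (hn : 0 < n)
    (hcop : Nat.Coprime m n) (p : Fin n → Fin m)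
    (hp : IsParkingWord m n (fun j => (p j : ℕ))) :
    ∃! x : Fin m → ℝ, x ∈ Vm m ∧ wordAct p x = x := by
  obtain ⟨x, hxV, hx⟩ := hp.exists_fixed_point hn
  exact ⟨x, ⟨hxV, hx⟩, fun y hy =>
    eq_of_wordAct_eq_self hcop p (hy.1.1.trans hxV.1.symm) hy.2 hx⟩
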